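/- Let p ≥ 5 be a prime number and let i, j be integers with 2 ≤ i < j. Then there is no d ≥ 1 and no lattice polytope P ⊂ ℝ^d of dimension d such that #(nP ∩ ℤ^d) = C(n+d, d) + C(n+d−i, d) + (p−2)·C(n+d−j, d) for every integer n ≥ 1; that is, no lattice polytope has h*-polynomial 1 + t^i + (p−2) t^j. -/

import Mathlib

open scoped Pointwise

/-- The coercion of an integer point to a real point. -/
def toReal {d : ℕ} (x : Fin d → ℤ) : Fin d → ℝ := fun i => (x i : ℝ)

/-- The number of lattice points in the `n`-th dilation of `P ⊆ ℝ^d`. -/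
noncomputable def latticeCount {d : ℕ} (P : Set (Fin d → ℝ)) (n : ℕ) : ℕ :=
  Set.ncard {x : Fin d → ℤ | toReal x ∈ (n : ℝ) • P}

/-- The finite abelian group `Λ_Δ` attached to a lattice simplex with vertices `v`. -/
def Lambda {d : ℕ} (v : Fin (d + 1) → Fin d → ℤ) : Set (Fin (d + 1) → ℝ) :=
  {r | (∀ j, 0 ≤ r j ∧ r j < 1) ∧
    (∀ i : Fin d, ∃ z : ℤ, ∑ j, r j * (v j i : ℝ) = (z : ℝ)) ∧
    (∃ z : ℤ, ∑ j, r j = (z : ℝ))}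

/-- The height `ht(α) = ∑ᵢ αᵢ`. -/
def ht {m : ℕ} (α : Fin m → ℝ) : ℝ := ∑ i, α i

/-- The support `supp(α) = {i : αᵢ > 0}`. -/
def suppOf {m : ℕ} (α : Fin m → ℝ) : Set (Fin m) := {i | 0 < α i}

/-- Addition on `Λ_Δ`: coordinatewise fractional part of the sum. -/
noncomputable def fadd {m : ℕ} (α β : Fin m → ℝ) : Fin m → ℝ := fun i => Int.fract (α i + β i)

/-- Negation on `Λ_Δ`: coordinatewise fractional part of `1 - αᵢ`. -/
noncomputable def fneg {m : ℕ} (α : Fin m → ℝ) : Fin m → ℝ := fun i => Int.fract (1 - α i)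

/-- `P ⊆ ℝ^d` is a lattice polytope of dimension `d`: the convex hull of a finite
set of lattice points whose affine span is all of `ℝ^d`. -/
def IsFullDimLatticePolytope {d : ℕ} (P : Set (Fin d → ℝ)) : Prop :=
  ∃ V : Finset (Fin d → ℤ),
    P = convexHull ℝ (toReal '' (V : Set (Fin d → ℤ))) ∧ affineSpan ℝ P = ⊤

/-- The barycentric weights of total mass `n` that represent lattice points. -/
def latticeWeights {d : ℕ} (v : Fin (d + 1) → Fin d → ℤ) (n : ℕ) : Set (Fin (d + 1) → ℝ) :=
  {w | (∀ j, 0 ≤ w j) ∧ (∀ i : Fin d, ∃ z : ℤ, ∑ j, w j * (v j i : ℝ) = (z : ℝ)) ∧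
    ∑ j, w j = (n : ℝ)}

lemma toReal_injective {d : ℕ} : Function.Injective (toReal (d := d)) := by
  intro x y h
  ext i
  have := congrFun h i
  simpa [toReal] using this

lemma exists_affineBasis_of_latticeCount_one {d : ℕ} {P : Set (Fin d → ℝ)}
    (hP : IsFullDimLatticePolytope P) (h1 : latticeCount P 1 = d + 1) :
    ∃ (v : Fin (d + 1) → Fin d → ℤ) (b : AffineBasis (Fin (d + 1)) ℝ (Fin d → ℝ)),
      (∀ j, b j = toReal (v j)) ∧ P = convexHull ℝ (Set.range b) := by
  obtain ⟨V, hV, hspan⟩ := hP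
  have hspan' : affineSpan ℝ (toReal '' (V : Set (Fin d → ℤ))) = ⊤ := by
    rwa [hV, affineSpan_convexHull] at hspan
  obtain ⟨s, hs, b, hb⟩ := AffineBasis.exists_affine_subbasis hspan'
  have hsfin : s.Finite := (V.finite_toSet.image _).subset hs
  have : Fintype s := hsfin.fintype
  have hcard : Fintype.card s = d + 1 := by
    simpa using b.card_eq_finrank_add_one
  have hVcard : V.card ≤ d + 1 := by
    rw [← h1, latticeCount, ← Set.ncard_coe_finset]
    refine Set.ncard_le_ncard ?_ (Set.finite_of_ncard_ne_zero ?_)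
    · intro x hx
      simp only [Set.mem_ofPred_eq, Nat.cast_one, one_smul, hV]
      exact subset_convexHull ℝ _ ⟨x, hx, rfl⟩
    · change latticeCount P 1 ≠ 0
      omega
  have hsV : s = toReal '' (V : Set (Fin d → ℤ)) := by
    refine Set.eq_of_subset_of_ncard_le hs ?_ (V.finite_toSet.image _)
    rw [Set.ncard_image_of_injective _ toReal_injective, Set.ncard_coe_finset,
      ← Nat.card_coe_set_eq, Nat.card_eq_fintype_card, hcard]
    exact hVcard
  let e : s ≃ Fin (d + 1) := Fintype.equivFinOfCardEq hcard
  have hmem : ∀ j, ∃ x : Fin d → ℤ, b.reindex e j = toReal x := by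
    intro j
    obtain ⟨x, -, hx⟩ := hs (e.symm j).2
    exact ⟨x, by rw [AffineBasis.reindex_apply, hb, hx]⟩
  choose v hv using hmem
  refine ⟨v, b.reindex e, hv, ?_⟩
  have : Set.range (b.reindex e) = s := by
    rw [AffineBasis.coe_reindex, EquivLike.range_comp, hb, Subtype.range_coe]
  rw [this, hsV, hV]

lemma latticeCount_eq_ncard_latticeWeights {d : ℕ} {v : Fin (d + 1) → Fin d → ℤ}
    {b : AffineBasis (Fin (d + 1)) ℝ (Fin d → ℝ)} (hb : ∀ j, b j = toReal (v j))
    {n : ℕ} (hn : 1 ≤ n) :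
    latticeCount (convexHull ℝ (Set.range b)) n = (latticeWeights v n).ncard := by
  have hn0 : (n : ℝ) ≠ 0 := by positivity
  let ψ : (Fin (d + 1) → ℝ) → Fin d → ℤ := fun w i => ⌊∑ j, w j * (v j i : ℝ)⌋
  have hψ : ∀ w ∈ latticeWeights v n, toReal (ψ w) = ∑ j, w j • b j := by
    rintro w ⟨-, hz, -⟩
    ext i
    obtain ⟨z, hz⟩ := hz i
    simp only [toReal, ψ, hz, Int.floor_intCast, Finset.sum_apply, Pi.smul_apply, hb,
      smul_eq_mul]
  have hcoord : ∀ w : Fin (d + 1) → ℝ, ∑ j, w j = n → ∀ k,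
      b.coord k ((n : ℝ)⁻¹ • ∑ j, w j • b j) = (n : ℝ)⁻¹ * w k := by
    intro w hw k
    have hsum : ∑ j, (n : ℝ)⁻¹ * w j = 1 := by
      rw [← Finset.mul_sum, hw, inv_mul_cancel₀ hn0]
    have := b.coord_apply_combination_of_mem (Finset.mem_univ k) hsum
    rw [Finset.affineCombination_eq_linear_combination _ _ _ hsum] at this
    rw [← this, Finset.smul_sum]
    simp only [smul_smul]
  have hinj : Set.InjOn ψ (latticeWeights v n) := by
    intro w hw w' hw' h
    have h' : ∑ j, w j • b j = ∑ j, w' j • b j := by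
      rw [← hψ w hw, ← hψ w' hw', h]
    ext k
    have := hcoord w hw.2.2 k
    rw [h', hcoord w' hw'.2.2 k] at this
    exact (mul_left_cancel₀ (inv_ne_zero hn0) this).symm
  rw [latticeCount, ← hinj.ncard_image]
  congr 1
  ext x
  rw [b.convexHull_eq_nonneg_coord]
  constructor
  · rintro ⟨y, hy, hyx⟩
    have hsum : ∑ j, ((n : ℝ) * b.coord j y) • b j = toReal x := by
      simp only [← smul_smul, ← Finset.smul_sum, b.linear_combination_coord_eq_self]
      exact hyx
    have hw : (fun j => (n : ℝ) * b.coord j y) ∈ latticeWeights v n := by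
      refine ⟨fun j => mul_nonneg (by positivity) (hy j), fun i => ⟨x i, ?_⟩, ?_⟩
      · have := congrFun hsum i
        simpa [hb, toReal] using this
      · rw [← Finset.mul_sum, b.sum_coord_apply_eq_one, mul_one]
    refine ⟨_, hw, toReal_injective ?_⟩
    rw [hψ _ hw, hsum]
  · rintro ⟨w, hw, rfl⟩
    rw [Set.mem_ofPred_eq, hψ w hw]
    refine ⟨(n : ℝ)⁻¹ • ∑ j, w j • b j, fun k => ?_, ?_⟩
    · rw [hcoord w hw.2.2 k]
      exact mul_nonneg (by positivity) (hw.1 k)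
    · exact smul_inv_smul₀ hn0 _

/-- The generating functions `∑ n, C(n + d - k, d) tⁿ = t ^ k / (1 - t) ^ (d + 1)` are linearly
independent, so a multiset of exponents is determined by the sum over it. -/
lemma Multiset.eq_of_sum_map_choose_eq {d : ℕ} (hd : 1 ≤ d) {M N : Multiset ℕ}
    (h : ∀ n : ℕ, (M.map fun k => Nat.choose (n + d - k) d).sum =
      (N.map fun k => Nat.choose (n + d - k) d).sum) : M = N := by
  have key : ∀ (L : Multiset ℕ) (n : ℕ), (L.map fun k => Nat.choose (n + d - k) d).sum =
      ∑ k ∈ Finset.range (n + 1), L.count k * Nat.choose (n + d - k) d := by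
    intro L n
    rw [Finset.sum_multiset_map_count]
    simp only [smul_eq_mul]
    refine Finset.sum_congr_of_eq_on_inter ?_ ?_ ?_
    · intro k _ hk
      rw [Nat.choose_eq_zero_of_lt, mul_zero]
      simp at hk
      omega
    · intro k _ hk
      rw [Multiset.count_eq_zero.2 (by simpa using hk), zero_mul]
    · intros; rfl
  ext n
  induction n using Nat.strong_induction_on with
  | _ n ih =>
    have hn := h n
    rw [key, key, Finset.sum_range_succ, Finset.sum_range_succ,
      Finset.sum_congr rfl (fun k hk => by rw [ih k (Finset.mem_range.1 hk)])] at hn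
    simpa using hn

lemma ht_fneg_add {m : ℕ} {α : Fin m → ℝ} (hα : ∀ j, 0 ≤ α j ∧ α j < 1) :
    ht (fneg α) + ht α = (suppOf α).ncard := by
  classical
  have : ∀ j, fneg α j + α j = if 0 < α j then 1 else 0 := by
    intro j
    obtain ⟨h0, h1⟩ := hα j
    split_ifs with h
    · rw [fneg, Int.fract_eq_self.2 ⟨by linarith, by linarith⟩]
      ring
    · have : α j = 0 := by linarith
      simp [fneg, this]
  rw [ht, ht, ← Finset.sum_add_distrib, Finset.sum_congr rfl (fun j _ => this j),
    Finset.sum_boole, ← Set.ncard_coe_finset]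
  simp [suppOf]

lemma fneg_fneg {m : ℕ} {α : Fin m → ℝ} (hα : ∀ j, 0 ≤ α j ∧ α j < 1) :
    fneg (fneg α) = α := by
  ext j
  obtain ⟨h0, h1⟩ := hα j
  rcases h0.eq_or_lt with h | h
  · simp [fneg, ← h]
  · have : fneg α j = 1 - α j := Int.fract_eq_self.2 ⟨by linarith, by linarith⟩
    rw [fneg, this, sub_sub_cancel, Int.fract_eq_self.2 ⟨h0, h1⟩]

/-- Reducing coordinates modulo `1` preserves the integrality conditions defining `Lambda`. -/
lemma fract_mem_Lambda {d : ℕ} {v : Fin (d + 1) → Fin d → ℤ} {w : Fin (d + 1) → ℝ}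
    (h1 : ∀ i : Fin d, ∃ z : ℤ, ∑ j, w j * (v j i : ℝ) = (z : ℝ))
    (h2 : ∃ z : ℤ, ∑ j, w j = (z : ℝ)) : (fun j => Int.fract (w j)) ∈ Lambda v := by
  refine ⟨fun j => ⟨Int.fract_nonneg _, Int.fract_lt_one _⟩, fun i => ?_, ?_⟩
  · obtain ⟨z, hz⟩ := h1 i
    refine ⟨z - ∑ j, ⌊w j⌋ * v j i, ?_⟩
    simp only [Int.fract, sub_mul, Finset.sum_sub_distrib, hz]
    push_cast
    rfl
  · obtain ⟨z, hz⟩ := h2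
    refine ⟨z - ∑ j, ⌊w j⌋, ?_⟩
    simp only [Int.fract, Finset.sum_sub_distrib, hz]
    push_cast
    rfl

lemma fneg_mem_Lambda {d : ℕ} {v : Fin (d + 1) → Fin d → ℤ} {α : Fin (d + 1) → ℝ}
    (hα : α ∈ Lambda v) : fneg α ∈ Lambda v := by
  obtain ⟨-, h1, z, hz⟩ := hα
  refine fract_mem_Lambda (w := fun j => 1 - α j) (fun i => ?_) ⟨(d + 1 : ℕ) - z, ?_⟩
  · obtain ⟨y, hy⟩ := h1 i
    refine ⟨∑ j, v j i - y, ?_⟩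
    simp [sub_mul, Finset.sum_sub_distrib, hy]
  · simp [Finset.sum_sub_distrib, hz]

/-- The subgroup of the torus that `Lambda v` represents. -/
def torusSubgroup {d : ℕ} (v : Fin (d + 1) → Fin d → ℤ) :
    AddSubgroup (Fin (d + 1) → UnitAddCircle) where
  carrier := (fun α j => (α j : UnitAddCircle)) '' Lambda v
  zero_mem' := ⟨0, ⟨by simp, fun i => ⟨0, by simp⟩, 0, by simp⟩, by ext j; simp⟩
  add_mem' := by
    rintro _ _ ⟨α, ⟨-, h1, z, hz⟩, rfl⟩ ⟨β, ⟨-, h2, y, hy⟩, rfl⟩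
    refine ⟨fadd α β, fract_mem_Lambda (w := fun j => α j + β j) (fun i => ?_) ⟨z + y, ?_⟩, ?_⟩
    · obtain ⟨s, hs⟩ := h1 i
      obtain ⟨t, ht⟩ := h2 i
      exact ⟨s + t, by simp [add_mul, Finset.sum_add_distrib, hs, ht]⟩
    · simp [Finset.sum_add_distrib, hz, hy]
    · ext j
      simp [fadd]
  neg_mem' := by
    rintro _ ⟨α, hα, rfl⟩
    refine ⟨fneg α, fneg_mem_Lambda hα, ?_⟩
    ext j
    simp [fneg]

lemma coe_injOn_Lambda {d : ℕ} (v : Fin (d + 1) → Fin d → ℤ) :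
    Set.InjOn (fun α j => (α j : UnitAddCircle) :
      (Fin (d + 1) → ℝ) → Fin (d + 1) → UnitAddCircle) (Lambda v) := by
  intro α hα β hβ h
  ext j
  have hj := congrFun h j
  exact (AddCircle.coe_eq_coe_iff_of_mem_Ico (p := 1) (a := 0)
    (by simpa using hα.1 j) (by simpa using hβ.1 j)).1 hj

lemma natCard_torusSubgroup {d : ℕ} (v : Fin (d + 1) → Fin d → ℤ) :
    Nat.card (torusSubgroup v) = (Lambda v).ncard := by
  rw [← (coe_injOn_Lambda v).ncard_image, ← Nat.card_coe_set_eq]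
  rfl

/-- If `Lambda v` has prime order, then all its nonzero elements have the same support. -/
lemma suppOf_subset_of_prime_ncard {d : ℕ} {v : Fin (d + 1) → Fin d → ℤ}
    (hp : (Lambda v).ncard.Prime) {α β : Fin (d + 1) → ℝ} (hα : α ∈ Lambda v)
    (hβ : β ∈ Lambda v) (hβ0 : β ≠ 0) : suppOf α ⊆ suppOf β := by
  intro k hk
  by_contra hk'
  have hβk : β k = 0 := le_antisymm (not_lt.1 hk') (hβ.1 k).1
  have : Fact (Nat.card (torusSubgroup v)).Prime := ⟨by rwa [natCard_torusSubgroup]⟩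
  let f : torusSubgroup v →+ UnitAddCircle :=
    (Pi.evalAddMonoidHom (fun _ : Fin (d + 1) => UnitAddCircle) k).comp (torusSubgroup v).subtype
  have h0 : (0 : Fin (d + 1) → ℝ) ∈ Lambda v := ⟨by simp, fun i => ⟨0, by simp⟩, 0, by simp⟩
  rcases f.ker.eq_bot_or_eq_top_of_prime_card with h | h
  · have hb : (⟨_, β, hβ, rfl⟩ : torusSubgroup v) ∈ f.ker := by
      simp [AddMonoidHom.mem_ker, f, hβk]
    rw [h, AddSubgroup.mem_bot] at hb
    refine hβ0 (coe_injOn_Lambda v hβ h0 ?_)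
    have := congrArg Subtype.val hb
    ext j
    simpa using congrFun this j
  · have ha : (⟨_, α, hα, rfl⟩ : torusSubgroup v) ∈ f.ker := by rw [h]; trivial
    have ha' : ((α k : ℝ) : UnitAddCircle) = ((0 : ℝ) : UnitAddCircle) := by
      simpa [AddMonoidHom.mem_ker, f] using ha
    have := (AddCircle.coe_eq_coe_iff_of_mem_Ico (p := 1) (a := 0)
      (by simpa using hα.1 k) (by simp)).1 ha'
    exact (ne_of_gt hk) this

lemma exists_nat_eq_ht {d : ℕ} {v : Fin (d + 1) → Fin d → ℤ} {α : Fin (d + 1) → ℝ}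
    (hα : α ∈ Lambda v) : ((⌊ht α⌋₊ : ℕ) : ℝ) = ht α := by
  obtain ⟨h, -, z, hz⟩ := hα
  have hz' : ht α = z := hz
  have h0 : (0 : ℝ) ≤ ht α := Finset.sum_nonneg fun j _ => (h j).1
  rw [hz'] at h0 ⊢
  lift z to ℕ using by exact_mod_cast h0
  simp

lemma latticeWeights_zero {d : ℕ} (v : Fin (d + 1) → Fin d → ℤ) : latticeWeights v 0 = {0} := by
  ext w
  constructor
  · rintro ⟨h, -, hs⟩
    rw [Nat.cast_zero, Finset.sum_eq_zero_iff_of_nonneg fun j _ => h j] at hs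
    ext j
    exact hs j (Finset.mem_univ j)
  · rintro rfl
    exact ⟨by simp, fun i => ⟨0, by simp⟩, by simp⟩

lemma Lambda_finite {d : ℕ} {v : Fin (d + 1) → Fin d → ℤ}
    (hfin : ∀ n, (latticeWeights v n).Finite) : (Lambda v).Finite := by
  refine ((Finset.range (d + 2)).finite_toSet.biUnion fun n _ => hfin n).subset ?_
  intro α hα
  have hle : ht α ≤ (d + 1 : ℕ) := by
    simpa [ht] using Finset.sum_le_sum fun j (_ : j ∈ Finset.univ) => (hα.1 j).2.le
  have := exists_nat_eq_ht hα
  simp only [Set.mem_iUnion]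
  refine ⟨⌊ht α⌋₊, ?_, fun j => (hα.1 j).1, hα.2.1, this.symm⟩
  rw [← this] at hle
  have : ⌊ht α⌋₊ ≤ d + 1 := by exact_mod_cast hle
  exact Finset.mem_coe.2 (Finset.mem_range.2 (by omega))

/-- The lattice weights of mass `n` with given fractional parts `α` are obtained from `α` by
distributing `n - ht α` units among the vertices. -/
lemma ncard_latticeWeights_fiber {d : ℕ} (hd : 1 ≤ d) {v : Fin (d + 1) → Fin d → ℤ}
    {α : Fin (d + 1) → ℝ} (hα : α ∈ Lambda v) (n : ℕ) :
    {w ∈ latticeWeights v n | (fun j => Int.fract (w j)) = α}.ncard =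
      Nat.choose (n + d - ⌊ht α⌋₊) d := by
  have hk := exists_nat_eq_ht hα
  set k := ⌊ht α⌋₊
  have hfloor : ∀ w ∈ latticeWeights v n, (fun j => Int.fract (w j)) = α →
      ∀ j, w j = ⌊w j⌋₊ + α j := by
    intro w hw h j
    rw [← congrFun h j, ← Int.self_sub_floor, ← natCast_floor_eq_intCast_floor (hw.1 j)]
    ring
  have hmass : ∀ w ∈ latticeWeights v n, (fun j => Int.fract (w j)) = α →
      ∑ j, ⌊w j⌋₊ + k = n := by
    intro w hw h
    have := hw.2.2
    rw [Finset.sum_congr rfl fun j _ => hfloor w hw h j, Finset.sum_add_distrib] at this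
    change _ + ht α = _ at this
    rw [← hk] at this
    exact_mod_cast this
  rcases lt_or_ge n k with hnk | hnk
  · rw [Nat.choose_eq_zero_of_lt (by omega), ← Set.ncard_empty (α := Fin (d + 1) → ℝ)]
    congr 1
    refine Set.eq_empty_of_forall_notMem fun w hw => ?_
    have := hmass w hw.1 hw.2
    omega
  · have hc' : Nat.choose (n + d - k) d =
        (Finset.finsuppAntidiag (Finset.univ : Finset (Fin (d + 1))) (n - k)).card := by
      rw [Finset.card_finsuppAntidiag_nat_eq_choose, Finset.card_univ, Fintype.card_fin, ← Nat.choose_symm_of_eq_add (a := n - k) (b := d)]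
      · congr 1; omega
      · omega
    let g : (Fin (d + 1) →₀ ℕ) → Fin (d + 1) → ℝ := fun m j => m j + α j
    have hg : Set.InjOn g
        (Finset.finsuppAntidiag (Finset.univ : Finset (Fin (d + 1))) (n - k)) := by
      intro m _ m' _ h
      ext j
      simpa [g] using congrFun h j
    rw [hc', ← Set.ncard_coe_finset, ← hg.ncard_image]
    congr 1
    ext w
    constructor
    · rintro ⟨hw, h⟩
      refine ⟨Finsupp.equivFunOnFinite.symm fun j => ⌊w j⌋₊, ?_, ?_⟩
      · simp only [Finset.mem_coe, Finset.mem_finsuppAntidiag, Finset.subset_univ, and_true]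
        have := hmass w hw h
        simp
        omega
      · ext j
        simpa [g] using (hfloor w hw h j).symm
    · rintro ⟨m, hm, rfl⟩
      simp only [Finset.mem_coe, Finset.mem_finsuppAntidiag, Finset.subset_univ, and_true] at hm
      refine ⟨⟨fun j => add_nonneg (by positivity) (hα.1 j).1, fun i => ?_, ?_⟩, ?_⟩
      · obtain ⟨z, hz⟩ := hα.2.1 i
        refine ⟨∑ j, m j * v j i + z, ?_⟩
        simp only [g, add_mul, Finset.sum_add_distrib, hz]
        push_cast
        rfl
      · simp only [g, Finset.sum_add_distrib]
        change _ + ht α = _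
        rw [← hk]
        have hm' : ∑ j, m j = n - k := hm
        have : ∑ j, m j + k = n := by omega
        exact_mod_cast this
      · ext j
        simpa [g] using hα.1 j

lemma ncard_latticeWeights {d : ℕ} (hd : 1 ≤ d) {v : Fin (d + 1) → Fin d → ℤ}
    (hfin : ∀ n, (latticeWeights v n).Finite) (n : ℕ) :
    (latticeWeights v n).ncard =
      ∑ α ∈ (Lambda_finite hfin).toFinset, Nat.choose (n + d - ⌊ht α⌋₊) d := by
  classical
  rw [Set.ncard_eq_toFinset_card _ (hfin n),
    Finset.card_eq_sum_card_fiberwise (f := fun w j => Int.fract (w j))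
      (t := (Lambda_finite hfin).toFinset)]
  · refine Finset.sum_congr rfl fun α hα => ?_
    rw [← ncard_latticeWeights_fiber hd ((Lambda_finite hfin).mem_toFinset.1 hα) n,
      ← Set.ncard_coe_finset]
    congr 1
    ext w
    simp
  · intro w hw
    obtain ⟨-, h1, h2⟩ : w ∈ latticeWeights v n := by simpa using hw
    simpa using fract_mem_Lambda h1 ⟨n, by simpa using h2⟩

/-- The heights in `Lambda v` cannot be `0` and `i` once each and `j > i` for the remaining `p - 2`
elements: negation would map the elements of height `j` injectively to those of height `i`. -/
lemma ht_multiset_ne {d : ℕ} {v : Fin (d + 1) → Fin d → ℤ} (hfin : (Lambda v).Finite)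
    {p i j : ℕ} (hp : p.Prime) (hp5 : 5 ≤ p) (hi : 2 ≤ i) (hij : i < j) :
    hfin.toFinset.val.map (fun α => ⌊ht α⌋₊) ≠ 0 ::ₘ i ::ₘ Multiset.replicate (p - 2) j := by
  intro hM
  have hcard : (Lambda v).ncard = p := by
    rw [Set.ncard_eq_toFinset_card _ hfin]
    have := congrArg Multiset.card hM
    simp only [Multiset.card_map, Finset.card_val, Multiset.card_cons,
      Multiset.card_replicate] at this
    omega
  have hprime : (Lambda v).ncard.Prime := hcard ▸ hp
  have hcount : ∀ k, (hfin.toFinset.filter fun α => ⌊ht α⌋₊ = k).card =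
      (0 ::ₘ i ::ₘ Multiset.replicate (p - 2) j).count k := by
    intro k
    rw [← hM, Multiset.count_map]
    simp only [Finset.card_def, Finset.filter_val, eq_comm]
  have hci := hcount i
  have hcj := hcount j
  rw [Multiset.count_cons_of_ne (by omega), Multiset.count_cons_self,
    Multiset.count_eq_zero.2 (by simp [Multiset.mem_replicate]; omega)] at hci
  rw [Multiset.count_cons_of_ne (by omega), Multiset.count_cons_of_ne (by omega),
    Multiset.count_replicate_self] at hcj
  have hht : ∀ α ∈ Lambda v, ⌊ht α⌋₊ = 0 ∨ ⌊ht α⌋₊ = i ∨ ⌊ht α⌋₊ = j := by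
    intro α hα
    have : ⌊ht α⌋₊ ∈ hfin.toFinset.val.map (fun α => ⌊ht α⌋₊) :=
      Multiset.mem_map_of_mem _ (by simpa using hα)
    rw [hM] at this
    simp only [Multiset.mem_cons, Multiset.mem_replicate] at this
    tauto
  have hzero : ∀ α ∈ Lambda v, ⌊ht α⌋₊ = 0 → α = 0 := by
    intro α hα h
    have : ht α = 0 := by rw [← exists_nat_eq_ht hα, h, Nat.cast_zero]
    rw [ht, Finset.sum_eq_zero_iff_of_nonneg fun j _ => (hα.1 j).1] at this
    ext j
    exact this j (Finset.mem_univ j)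
  obtain ⟨α, hα⟩ := Finset.card_pos.1 (by omega :
    0 < (hfin.toFinset.filter fun α => ⌊ht α⌋₊ = i).card)
  simp only [Finset.mem_filter, Set.Finite.mem_toFinset] at hα
  obtain ⟨hα, hαi⟩ := hα
  have hne : ∀ β : Fin (d + 1) → ℝ, ⌊ht β⌋₊ ≠ 0 → β ≠ 0 := by
    rintro β h rfl
    simp [ht] at h
  have hneg : ∀ β ∈ Lambda v, ⌊ht β⌋₊ ≠ 0 → ⌊ht (fneg β)⌋₊ + ⌊ht β⌋₊ = (suppOf α).ncard := by
    intro β hβ hβ0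
    have hs : suppOf β = suppOf α :=
      (suppOf_subset_of_prime_ncard hprime hβ hα (hne α (by omega))).antisymm
        (suppOf_subset_of_prime_ncard hprime hα hβ (hne β hβ0))
    have := ht_fneg_add hβ.1
    rw [← exists_nat_eq_ht hβ, ← exists_nat_eq_ht (fneg_mem_Lambda hβ), hs] at this
    exact_mod_cast this
  have hneg0 : ∀ β ∈ Lambda v, ⌊ht β⌋₊ ≠ 0 → ⌊ht (fneg β)⌋₊ ≠ 0 := by
    intro β hβ h0 h
    have := fneg_fneg hβ.1
    rw [hzero _ (fneg_mem_Lambda hβ) h] at this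
    refine hne β h0 (this.symm.trans ?_)
    ext j
    simp [fneg]
  have hle : (hfin.toFinset.filter fun α => ⌊ht α⌋₊ = j).card ≤
      (hfin.toFinset.filter fun α => ⌊ht α⌋₊ = i).card := by
    refine Finset.card_le_card_of_injOn fneg ?_ ?_
    · intro β hβ
      simp only [Finset.coe_filter, Set.mem_ofPred_eq, Set.Finite.mem_toFinset] at hβ ⊢
      obtain ⟨hβ, hβj⟩ := hβ
      refine ⟨fneg_mem_Lambda hβ, ?_⟩
      have h1 := hneg α hα (by omega)
      have h2 := hneg β hβ (by omega)
      have h3 := hht _ (fneg_mem_Lambda hα)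
      have h4 := hht _ (fneg_mem_Lambda hβ)
      have h5 := hneg0 α hα (by omega)
      have h6 := hneg0 β hβ (by omega)
      omega
    · intro β hβ γ hγ h
      simp only [Finset.coe_filter, Set.mem_ofPred_eq, Set.Finite.mem_toFinset] at hβ hγ
      rw [← fneg_fneg hβ.1.1, h, fneg_fneg hγ.1.1]
  omega

/-- for a prime `p ≥ 5` and `2 ≤ i < j`, no lattice polytope has
h*-polynomial `1 + t^i + (p-2) t^j`. -/
theorem stmt10 (p : ℕ) (hp : p.Prime) (hp5 : 5 ≤ p) (i j : ℕ) (hi : 2 ≤ i) (hij : i < j) :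
    ¬ ∃ (d : ℕ) (P : Set (Fin d → ℝ)), 1 ≤ d ∧ IsFullDimLatticePolytope P ∧
      ∀ n : ℕ, 1 ≤ n →
        latticeCount P n =
          Nat.choose (n + d) d + Nat.choose (n + d - i) d +
            (p - 2) * Nat.choose (n + d - j) d := by
  rintro ⟨d, P, hd, hP, hcount⟩
  have h1 : latticeCount P 1 = d + 1 := by
    rw [hcount 1 le_rfl, Nat.choose_eq_zero_of_lt (by omega : 1 + d - i < d),
      Nat.choose_eq_zero_of_lt (by omega : 1 + d - j < d), add_comm 1 d]
    simp
  obtain ⟨v, b, hb, rfl⟩ := exists_affineBasis_of_latticeCount_one hP h1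
  have hw : ∀ n, (latticeWeights v n).ncard = Nat.choose (n + d) d + Nat.choose (n + d - i) d +
      (p - 2) * Nat.choose (n + d - j) d := by
    intro n
    rcases Nat.eq_zero_or_pos n with rfl | hn
    · rw [latticeWeights_zero, Set.ncard_singleton,
        Nat.choose_eq_zero_of_lt (by omega : 0 + d - i < d),
        Nat.choose_eq_zero_of_lt (by omega : 0 + d - j < d)]
      simp
    · rw [← latticeCount_eq_ncard_latticeWeights hb hn, hcount n hn]
  have hfin : ∀ n, (latticeWeights v n).Finite := by
    intro n
    refine Set.finite_of_ncard_ne_zero ?_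
    have := Nat.choose_pos (Nat.le_add_left d n)
    rw [hw]
    omega
  refine ht_multiset_ne (Lambda_finite hfin) hp hp5 hi hij
    (Multiset.eq_of_sum_map_choose_eq hd fun n => ?_)
  have := ncard_latticeWeights hd hfin n
  rw [hw] at this
  rw [Multiset.map_map]
  refine this.symm.trans ?_
  simp [add_assoc]
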